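/- Define α_n = (-1)^n q^{n(n-1)/2} (1 - q^n) H(n) and β_n = (q;q)_∞ (q^n − 1) q^{n(n-1)} / (q;q)_{2n}, where H(n) = ∑_{k∈ℤ} (-1)^k q^{3k(k-1)/2} (1 - q^k) q^{(1+n)k}. Then (α_n, β_n) is a Bailey pair relative to a = 1, i.e., for all n ≥ 0: β_n = ∑_{k=0}^{n} α_k / ((q;q)_{n-k} (q;q)_{n+k}). -/

import Mathlib

noncomputable def qp (q x : ℂ) (n : ℕ) : ℂ := ∏ i ∈ Finset.range n, (1 - x * q ^ i)

noncomputable def qpInf (q x : ℂ) : ℂ := ∏' i : ℕ, (1 - x * q ^ i)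

noncomputable def H (q : ℂ) (n : ℤ) : ℂ :=
  ∑' k : ℤ, (-1 : ℂ) ^ k * q ^ (3 * (k * (k - 1) / 2)) * (1 - q ^ k) * q ^ ((1 + n) * k)


noncomputable def rr (q : ℂ) (m : ℤ) : ℂ := if m < 0 then 0 else (qp q q m.toNat)⁻¹

noncomputable def sg (q : ℂ) (k : ℤ) : ℂ := (-1 : ℂ) ^ k * q ^ (k * (k - 1) / 2)

noncomputable def cc (q : ℂ) (n : ℕ) (k : ℤ) : ℂ := sg q k * rr q (n - k) * rr q (n + k)

noncomputable def ww (q : ℂ) (i k : ℤ) : ℂ := (-1 : ℂ) ^ k * q ^ (3 * (k * (k - 1) / 2) + i * k)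

noncomputable def TT (q : ℂ) (i : ℤ) : ℂ := ∑' k : ℤ, ww q i k

noncomputable def MM (q : ℂ) (n : ℕ) (i : ℤ) : ℂ := ∑' k : ℤ, cc q n k * TT q (i + k)

lemma one_sub_pow_ne {q : ℂ} (h1 : ‖q‖ < 1) (m : ℕ) : 1 - q ^ (m + 1) ≠ 0 := by
  intro h
  have h2 : ‖q ^ (m + 1)‖ = 1 := by rw [← sub_eq_zero.mp h]; simp
  rw [norm_pow] at h2
  have := pow_lt_one₀ (norm_nonneg q) h1 (Nat.succ_ne_zero m)
  simp only [Nat.succ_eq_add_one] at this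
  linarith

lemma qp_succ (q : ℂ) (m : ℕ) : qp q q (m + 1) = qp q q m * (1 - q ^ (m + 1)) := by
  rw [qp, qp, Finset.prod_range_succ, pow_succ']

lemma qp_ne {q : ℂ} (h1 : ‖q‖ < 1) (m : ℕ) : qp q q m ≠ 0 := by
  induction m with
  | zero => simp [qp]
  | succ m ih => rw [qp_succ]; exact mul_ne_zero ih (one_sub_pow_ne h1 m)

lemma rr_rec {q : ℂ} (h1 : ‖q‖ < 1) (m : ℤ) : rr q (m - 1) = (1 - q ^ m) * rr q m := by
  rcases lt_trichotomy m 0 with h | h | h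
  · rw [rr, rr, if_pos (by omega), if_pos h, mul_zero]
  · subst h; simp [rr]
  · obtain ⟨j, rfl⟩ : ∃ j : ℕ, m = j + 1 := ⟨(m - 1).toNat, by omega⟩
    rw [rr, rr, if_neg (by omega), if_neg (by omega)]
    have e1 : ((j : ℤ) + 1 - 1).toNat = j := by omega
    have e2 : ((j : ℤ) + 1).toNat = j + 1 := by omega
    rw [e1, e2, qp_succ]
    have := qp_ne h1 j
    have := one_sub_pow_ne h1 j
    have e3 : q ^ ((j : ℤ) + 1) = q ^ (j + 1) := by exact_mod_cast zpow_natCast q (j + 1)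
    rw [e3]
    field_simp

lemma sg_succ {q : ℂ} (hq : q ≠ 0) (k : ℤ) : sg q (k + 1) = - q ^ k * sg q k := by
  have e : (k + 1) * (k + 1 - 1) / 2 = k * (k - 1) / 2 + k := by
    rw [show (k + 1) * (k + 1 - 1) = k * (k - 1) + k * 2 by ring, Int.add_mul_ediv_right _ _ (by norm_num)]
  rw [sg, sg, e, zpow_add₀ hq, zpow_add₀ (by norm_num)]
  ring

lemma sg_neg {q : ℂ} (hq : q ≠ 0) (k : ℤ) : sg q (-k) = q ^ k * sg q k := by
  have e : (-k) * (-k - 1) / 2 = k + k * (k - 1) / 2 := by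
    rw [show (-k) * (-k - 1) = k * (k - 1) + k * 2 by ring, Int.add_mul_ediv_right _ _ (by norm_num)]
    ring
  have e2 : (-1 : ℂ) ^ (-k) = (-1) ^ k := by
    rw [zpow_neg, ← inv_zpow]; norm_num
  rw [sg, sg, e, zpow_add₀ hq, e2]
  ring

lemma cc_neg {q : ℂ} (hq : q ≠ 0) (n : ℕ) (k : ℤ) : cc q n (-k) = q ^ k * cc q n k := by
  rw [cc, cc, sg_neg hq, sub_neg_eq_add, ← sub_eq_add_neg]
  ring

lemma cc_succ {q : ℂ} (hq : q ≠ 0) (h1 : ‖q‖ < 1) (n : ℕ) (k : ℤ) :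
    (1 - q ^ (n + k + 1)) * cc q n (k + 1) = (q ^ n - q ^ k) * cc q n k := by
  have a := rr_rec h1 (n - k)
  have b := rr_rec h1 (n + k + 1)
  rw [cc, cc, sg_succ hq, show (n : ℤ) - (k + 1) = n - k - 1 by ring, a,
    show (n : ℤ) + (k + 1) = n + k + 1 by ring]
  rw [show (n : ℤ) + k + 1 - 1 = n + k by ring] at b
  rw [b, zpow_sub₀ hq]
  have := zpow_ne_zero k hq
  rw [zpow_natCast]
  field_simp
  ring

lemma cc_rec {q : ℂ} (hq : q ≠ 0) (h1 : ‖q‖ < 1) (n : ℕ) (k : ℤ) :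
    (1 - q ^ (2 * n + 1)) * (1 - q ^ (2 * n + 2)) * cc q (n + 1) k =
      (1 + q ^ (2 * n + 1)) * cc q n k - q ^ n * cc q n (k - 1) - q ^ (n + 1) * cc q n (k + 1) := by
  have a1 := rr_rec h1 (n + 1 - k)
  have a2 := rr_rec h1 (n - k)
  have b1 := rr_rec h1 (n + 1 + k)
  have b2 := rr_rec h1 (n + k)
  have s1 := sg_succ hq k
  have s2 := sg_succ hq (k - 1)
  rw [sub_add_cancel] at s2
  rw [show (n : ℤ) + 1 - k - 1 = n - k by ring] at a1
  rw [show (n : ℤ) + 1 + k - 1 = n + k by ring] at b1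
  have hk := zpow_ne_zero k hq
  have s3 : sg q (k - 1) = - q * (q ^ k)⁻¹ * sg q k := by
    rw [s2, zpow_sub₀ hq, zpow_one]; field_simp
  simp only [cc]
  push_cast
  rw [show (n : ℤ) - (k + 1) = n - k - 1 by ring, show (n : ℤ) + (k - 1) = n + k - 1 by ring,
    show (n : ℤ) - (k - 1) = n + 1 - k by ring, show (n : ℤ) + (k + 1) = n + 1 + k by ring,
    s1, s3, a2, b2, a1, b1]
  simp only [zpow_sub₀ hq, zpow_add₀ hq, zpow_one, zpow_natCast]
  field_simp
  ring

lemma cc_zero_of (q : ℂ) (n : ℕ) (k : ℤ) (hk : k ∉ Finset.Icc (-(n : ℤ)) n) : cc q n k = 0 := by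
  rw [Finset.mem_Icc, not_and_or] at hk
  rcases hk with h | h
  · rw [cc, rr, rr, if_pos (show (n : ℤ) + k < 0 by omega), mul_zero]
  · rw [cc, rr, rr, if_pos (show (n : ℤ) - k < 0 by omega), mul_zero, zero_mul]

lemma cc_summable (q : ℂ) (n : ℕ) (f : ℤ → ℂ) : Summable (fun k => cc q n k * f k) :=
  summable_of_ne_finset_zero (s := Finset.Icc (-(n : ℤ)) n)
    (fun k hk => by rw [cc_zero_of q n k hk, zero_mul])

lemma neg_one_zpow_neg (k : ℤ) : (-1 : ℂ) ^ (-k) = (-1) ^ k := by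
  rw [zpow_neg, ← inv_zpow]; norm_num

lemma TT_shift {q : ℂ} (hq : q ≠ 0) (i : ℤ) : TT q (i + 3) = - (q ^ i)⁻¹ * TT q i := by
  have h : TT q i = - q ^ i * TT q (i + 3) := by
    rw [TT, ← (Equiv.addRight (1 : ℤ)).tsum_eq, TT, ← tsum_mul_left]
    congr 1
    ext k
    simp only [Equiv.coe_addRight, ww]
    have e : (k + 1) * (k + 1 - 1) / 2 = k * (k - 1) / 2 + k := by
      rw [show (k + 1) * (k + 1 - 1) = k * (k - 1) + k * 2 by ring, Int.add_mul_ediv_right _ _ (by norm_num)]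
    rw [e, show 3 * (k * (k - 1) / 2 + k) + i * (k + 1) = i + (3 * (k * (k - 1) / 2) + (i + 3) * k) by ring,
      zpow_add₀ hq, zpow_add₀ (by norm_num : (-1 : ℂ) ≠ 0)]
    ring
  have := zpow_ne_zero i hq
  rw [h]; field_simp

lemma TT_neg (q : ℂ) (i : ℤ) : TT q (-i) = TT q (i + 3) := by
  rw [TT, ← (Equiv.neg ℤ).tsum_eq, TT]
  congr 1
  ext k
  simp only [Equiv.neg_apply, ww]
  have e : (-k) * (-k - 1) / 2 = k + k * (k - 1) / 2 := by
    rw [show (-k) * (-k - 1) = k * (k - 1) + k * 2 by ring, Int.add_mul_ediv_right _ _ (by norm_num)]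
    ring
  rw [e, neg_one_zpow_neg]
  ring_nf

lemma MM_neg {q : ℂ} (hq : q ≠ 0) (n : ℕ) (i : ℤ) : MM q n (-i) = - (q ^ i)⁻¹ * MM q n i := by
  rw [MM, ← (Equiv.neg ℤ).tsum_eq, MM, ← tsum_mul_left]
  congr 1
  ext k
  simp only [Equiv.neg_apply]
  rw [cc_neg hq, ← neg_add, TT_neg, TT_shift hq, zpow_add₀ hq]
  have := zpow_ne_zero k hq
  field_simp

lemma MM_zero {q : ℂ} (hq : q ≠ 0) (n : ℕ) : MM q n 0 = 0 := by
  have := MM_neg hq n 0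
  simp at this
  linear_combination this / 2

lemma MM_key {q : ℂ} (hq : q ≠ 0) (h1 : ‖q‖ < 1) (n : ℕ) (e : ℤ) :
    MM q n e - q ^ (n + 1) * MM q n (e - 1) - q ^ e * MM q n (e + 2)
      + q ^ (e + n) * MM q n (e + 3) = 0 := by
  have h3 : q ^ (e + n) * MM q n (e + 3) = ∑' k : ℤ, cc q n k * (- q ^ (n - k) * TT q (e + k)) := by
    rw [MM, ← tsum_mul_left]
    congr 1; ext k
    rw [show e + 3 + k = e + k + 3 by ring, TT_shift hq, zpow_add₀ hq, zpow_add₀ hq, zpow_sub₀ hq]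
    have := zpow_ne_zero k hq
    have := zpow_ne_zero e hq
    field_simp
  have h2 : q ^ e * MM q n (e + 2) = ∑' k : ℤ, cc q n (k + 1) * (- q ^ (- k) * TT q (e + k)) := by
    rw [MM, ← tsum_mul_left, ← (Equiv.addRight (1 : ℤ)).tsum_eq]
    congr 1; ext k
    simp only [Equiv.coe_addRight]
    rw [show e + 2 + (k + 1) = e + k + 3 by ring, TT_shift hq, zpow_add₀ hq, zpow_neg]
    have := zpow_ne_zero k hq
    have := zpow_ne_zero e hq
    field_simp
  have h4 : q ^ (n + 1) * MM q n (e - 1) = ∑' k : ℤ, cc q n (k + 1) * (q ^ (n + 1) * TT q (e + k)) := by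
    rw [MM, ← tsum_mul_left, ← (Equiv.addRight (1 : ℤ)).tsum_eq]
    congr 1; ext k
    simp only [Equiv.coe_addRight]
    rw [show e - 1 + (k + 1) = e + k by ring]
    ring
  have sh : ∀ f : ℤ → ℂ, Summable (fun k => cc q n (k + 1) * f k) := by
    intro f
    have := (Equiv.addRight (1 : ℤ)).summable_iff.mpr (cc_summable q n (fun k => f (k - 1)))
    refine this.congr ?_
    intro k
    simp
  rw [h2, h3, h4, MM, ← (cc_summable q n _).tsum_sub (sh _),
    ← Summable.tsum_sub ((cc_summable q n _).sub (sh _)) (sh _),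
    ← Summable.tsum_add (((cc_summable q n _).sub (sh _)).sub (sh _)) (cc_summable q n _)]
  rw [← tsum_zero (β := ℤ)]
  congr 1; ext k
  have := cc_succ hq h1 n k
  rw [zpow_add₀ hq, zpow_add₀ hq, zpow_one, zpow_natCast] at this
  rw [zpow_sub₀ hq, zpow_neg, zpow_natCast]
  have hk := zpow_ne_zero k hq
  field_simp
  linear_combination TT q (e + k) * this

lemma MM_one_two {q : ℂ} (hq : q ≠ 0) (h1 : ‖q‖ < 1) (n : ℕ) : MM q n 1 = q ^ n * MM q n 2 := by
  have h := MM_key hq h1 n (-1)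
  have a := MM_neg hq n 1
  have b := MM_neg hq n 2
  norm_num at h
  rw [a, b, zpow_add₀ hq, zpow_neg, zpow_one, zpow_natCast] at h
  have e : q ^ (2 : ℤ) = q ^ 2 := by norm_cast
  rw [e] at h
  field_simp at h
  have h' : q ^ 2 * (MM q n 1 - q ^ n * MM q n 2) = 0 := by linear_combination (- q / 2) * h
  rcases mul_eq_zero.mp h' with h | h
  · exact absurd h (pow_ne_zero 2 hq)
  · exact sub_eq_zero.mp h

lemma MM_rec {q : ℂ} (hq : q ≠ 0) (h1 : ‖q‖ < 1) (n : ℕ) :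
    (1 - q ^ (2 * n + 1)) * (1 - q ^ (2 * n + 2)) * MM q (n + 1) 1 = q ^ (2 * n + 1) * MM q n 1 := by
  have e0 : ∀ k : ℤ, (1 - q ^ (2 * n + 1)) * (1 - q ^ (2 * n + 2)) * (cc q (n + 1) k * TT q (1 + k))
      = cc q n k * ((1 + q ^ (2 * n + 1)) * TT q (1 + k)) - cc q n (k - 1) * (q ^ n * TT q (1 + k))
        - cc q n (k + 1) * (q ^ (n + 1) * TT q (1 + k)) := by
    intro k
    linear_combination TT q (1 + k) * cc_rec hq h1 n k
  have sh : ∀ (j : ℤ) (f : ℤ → ℂ), Summable (fun k => cc q n (k + j) * f k) := by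
    intro j f
    have := (Equiv.addRight j).summable_iff.mpr (cc_summable q n (fun k => f (k - j)))
    refine this.congr ?_
    intro k
    simp
  have t1 : ∑' k : ℤ, cc q n k * ((1 + q ^ (2 * n + 1)) * TT q (1 + k))
      = (1 + q ^ (2 * n + 1)) * MM q n 1 := by
    rw [MM, ← tsum_mul_left]; congr 1; ext k; ring
  have t2 : ∑' k : ℤ, cc q n (k - 1) * (q ^ n * TT q (1 + k)) = q ^ n * MM q n 2 := by
    rw [MM, ← tsum_mul_left, ← (Equiv.addRight (1 : ℤ)).tsum_eq]; congr 1; ext k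
    simp only [Equiv.coe_addRight, add_sub_cancel_right]
    rw [show 1 + (k + 1) = 2 + k by ring]; ring
  have t3 : ∑' k : ℤ, cc q n (k + 1) * (q ^ (n + 1) * TT q (1 + k)) = q ^ (n + 1) * MM q n 0 := by
    rw [MM, ← tsum_mul_left, ← (Equiv.addRight (-1 : ℤ)).tsum_eq]; congr 1; ext k
    simp only [Equiv.coe_addRight, neg_add_cancel_right]
    rw [show 1 + (k + -1) = 0 + k by ring]; ring
  rw [MM, ← tsum_mul_left]
  simp_rw [e0]
  have s2 := sh (-1) (fun k => q ^ n * TT q (1 + k))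
  simp only [← sub_eq_add_neg] at s2
  rw [Summable.tsum_sub ((cc_summable q n _).sub s2) (sh 1 _), Summable.tsum_sub (cc_summable q n _) s2,
    t1, t2, t3, MM_zero hq, ← MM_one_two hq h1]
  ring

lemma MM_closed {q : ℂ} (hq : q ≠ 0) (h1 : ‖q‖ < 1) (n : ℕ) :
    MM q n 1 = q ^ (n * n) * TT q 1 / qp q q (2 * n) := by
  induction n with
  | zero =>
    rw [MM, tsum_eq_single 0]
    · simp [cc, rr, sg, qp]
    · intro k hk
      rw [cc_zero_of q 0 k (by simpa using hk), zero_mul]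
  | succ n ih =>
    have h := MM_rec hq h1 n
    have a1 := one_sub_pow_ne h1 (2 * n)
    have a2 := one_sub_pow_ne h1 (2 * n + 1)
    have a3 := qp_ne h1 (2 * n)
    rw [ih] at h
    rw [show 2 * (n + 1) = 2 * n + 1 + 1 by ring, qp_succ, qp_succ]
    have a2' : 1 - q ^ (2 * n + 2) ≠ 0 := a2
    rw [show 2 * n + 1 + 1 = 2 * n + 2 by ring]
    rw [eq_div_iff (by positivity)]
    have : MM q (n + 1) 1 * (qp q q (2 * n) * (1 - q ^ (2 * n + 1)) * (1 - q ^ (2 * n + 2)))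
      = qp q q (2 * n) * ((1 - q ^ (2 * n + 1)) * (1 - q ^ (2 * n + 2)) * MM q (n + 1) 1) := by ring
    rw [this, h]
    field_simp
    ring

lemma ww_summable {q : ℂ} (hq : q ≠ 0) (h1 : ‖q‖ < 1) (i : ℤ) : Summable (ww q i) := by
  set t : ℂ := Complex.log q / (2 * Real.pi * Complex.I) with ht
  have hpi : (2 * Real.pi * Complex.I : ℂ) ≠ 0 := Complex.two_pi_I_ne_zero
  have ht2 : 2 * Real.pi * Complex.I * t = Complex.log q := by rw [ht]; field_simp
  have him : 0 < (3 * t).im := by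
    have h2 : (Complex.log q).re < 0 := by
      rw [Complex.log_re]; exact Real.log_neg (norm_pos_iff.mpr hq) h1
    have h3 : (2 * Real.pi * Complex.I * t).re = - (2 * Real.pi * t.im) := by simp
    rw [ht2] at h3
    have h4 : 0 < 2 * Real.pi * t.im := by linarith
    have h5 : 0 < t.im := by
      by_contra hc
      push Not at hc
      have := mul_nonpos_of_nonneg_of_nonpos (by positivity : 0 ≤ 2 * Real.pi) hc
      linarith
    simp
    exact h5
  refine ((summable_jacobiTheta₂_term_iff (1 / 2 - 3 * t / 2 + i * t) (3 * t)).mpr him).congr ?_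
  intro k
  rw [jacobiTheta₂_term, ww]
  obtain ⟨d, hd⟩ : ∃ d : ℤ, k * (k - 1) = 2 * d := (Int.even_mul_pred_self k).two_dvd
  have hd' : (k : ℂ) * (k - 1) = 2 * d := by exact_mod_cast hd
  rw [hd, Int.mul_ediv_cancel_left _ (by norm_num)]
  have e1 : (-1 : ℂ) ^ k = Complex.exp (k * (Real.pi * Complex.I)) := by
    rw [Complex.exp_int_mul, Complex.exp_pi_mul_I]
  have e2 : q ^ (3 * d + i * k) = Complex.exp ((3 * d + i * k : ℤ) * Complex.log q) := by
    rw [Complex.exp_int_mul, Complex.exp_log hq]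
  rw [e1, e2, ← Complex.exp_add, ← ht2]
  congr 1
  push_cast
  linear_combination (3 * Real.pi * Complex.I * t) * hd'

lemma H_eq {q : ℂ} (hq : q ≠ 0) (h1 : ‖q‖ < 1) (n : ℤ) : H q n = TT q (1 + n) - TT q (2 + n) := by
  rw [TT, TT, ← (ww_summable hq h1 _).tsum_sub (ww_summable hq h1 _), H]
  congr 1; ext k
  rw [ww, ww, zpow_add₀ hq, zpow_add₀ hq, show (2 + n) * k = k + (1 + n) * k by ring, zpow_add₀ hq]
  ring

lemma prod_bound {q : ℂ} (h1 : ‖q‖ < 1) : ∃ C : ℝ, 0 ≤ C ∧ ∀ k n : ℕ,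
    ‖∏ i ∈ Finset.range n, (1 - q ^ (k + i + 1))‖ ≤ C := by
  refine ⟨Real.exp (∑' i : ℕ, ‖q‖ ^ i), (Real.exp_pos _).le, fun k n => ?_⟩
  rw [norm_prod]
  calc ∏ i ∈ Finset.range n, ‖1 - q ^ (k + i + 1)‖
      ≤ ∏ i ∈ Finset.range n, Real.exp (‖q‖ ^ i) := by
        apply Finset.prod_le_prod (fun _ _ => norm_nonneg _)
        intro i _
        have a : ‖1 - q ^ (k + i + 1)‖ ≤ 1 + ‖q‖ ^ (k + i + 1) := by
          refine (norm_sub_le _ _).trans ?_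
          simp
        have b : ‖q‖ ^ (k + i + 1) ≤ ‖q‖ ^ i :=
          pow_le_pow_of_le_one (norm_nonneg _) h1.le (by omega)
        have c := Real.add_one_le_exp (‖q‖ ^ i)
        linarith
    _ = Real.exp (∑ i ∈ Finset.range n, ‖q‖ ^ i) := (Real.exp_sum _ _).symm
    _ ≤ _ := by
        apply Real.exp_le_exp.mpr
        exact (summable_geometric_of_lt_one (norm_nonneg _) h1).sum_le_tsum _
          (fun i _ => by positivity)

lemma ww_one {q : ℂ} (k : ℤ) : ww q 1 k = (-1) ^ k * q ^ pentagonal k := by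
  rw [ww]
  have h := two_mul_natCast_pentagonal k
  obtain ⟨d, hd⟩ : ∃ d : ℤ, k * (k - 1) = 2 * d := (Int.even_mul_pred_self k).two_dvd
  rw [hd, Int.mul_ediv_cancel_left _ (by norm_num)]
  have : 3 * d + 1 * k = (pentagonal k : ℤ) := by linarith
  rw [this, zpow_natCast]

lemma TT_one {q : ℂ} (hq : q ≠ 0) (h1 : ‖q‖ < 1) : TT q 1 = qpInf q q := by
  have hs := ww_summable hq h1 1
  have hs' : Summable (fun k : ℤ => ww q 1 (-k)) := (Equiv.neg ℤ).summable_iff.mpr hs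
  have i1 : Summable (fun k : ℕ => ww q 1 (-(k : ℤ))) := hs'.comp_injective Nat.cast_injective
  have i2 : Summable (fun k : ℕ => ww q 1 ((k : ℤ) + 1)) :=
    hs.comp_injective (i := fun k : ℕ => (k : ℤ) + 1) (fun a b h => by simpa using h)
  have ev : ∀ k : ℕ, ww q 1 (-(k : ℤ)) + ww q 1 ((k : ℤ) + 1)
      = (-1) ^ k * (q ^ pentagonal (-k) - q ^ pentagonal (k + 1)) := by
    intro k
    rw [ww_one, ww_one, neg_one_zpow_neg, zpow_add₀ (by norm_num), zpow_natCast]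
    ring
  have e1 : TT q 1 = ∑' k : ℕ, (-1) ^ k * (q ^ pentagonal (-k) - q ^ pentagonal (k + 1)) := by
    rw [TT, ← (Equiv.neg ℤ).tsum_eq]
    simp only [Equiv.neg_apply]
    rw [tsum_of_nat_of_neg_add_one (f := fun k : ℤ => ww q 1 (-k)) i1 (by simpa using i2)]
    simp only [neg_neg]
    rw [← i1.tsum_add i2]
    exact tsum_congr ev
  obtain ⟨C, hC, hb⟩ := prod_bound h1
  have gs := summable_geometric_of_lt_one (norm_nonneg q) h1
  have bd : ∀ k n : ℕ, ‖q ^ ((k + 1) * n) * ∏ i ∈ Finset.range (n + 1), (1 - q ^ (k + i + 1))‖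
      ≤ C * ‖q‖ ^ n := by
    intro k n
    rw [norm_mul, norm_pow, mul_comm]
    apply mul_le_mul (hb k _) _ (by positivity) hC
    exact pow_le_pow_of_le_one (norm_nonneg _) h1.le (by nlinarith)
  have p := Pentagonal.tprod_one_sub_pow (x := q) ?_ ?_ ?_ ?_ ?_
  · rw [e1, ← p, qpInf]
    refine tprod_congr fun n => ?_
    rw [pow_succ']
  · exact tendsto_pow_atTop_nhds_zero_of_norm_lt_one h1
  · intro k
    exact Summable.of_norm_bounded (gs.mul_left C) (bd k)
  · intro k
    have : Summable (fun n : ℕ => ‖-q ^ (n + k + 1)‖) := by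
      refine Summable.of_nonneg_of_le (fun _ => norm_nonneg _) (fun n => ?_) gs
      rw [norm_neg, norm_pow]
      exact pow_le_pow_of_le_one (norm_nonneg _) h1.le (by omega)
    simpa [sub_eq_add_neg] using multipliable_one_add_of_summable this
  · exact (i1.add i2).congr ev
  · have g := (tendsto_pow_atTop_nhds_zero_of_lt_one (norm_nonneg q) h1).mul_const
      (∑' n : ℕ, C * ‖q‖ ^ n)
    rw [zero_mul] at g
    refine squeeze_zero_norm (fun k => ?_) g
    rw [norm_mul, norm_mul, norm_pow, norm_neg, norm_one, one_pow, one_mul, norm_pow]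
    apply mul_le_mul _ _ (norm_nonneg _) (by positivity)
    · apply pow_le_pow_of_le_one (norm_nonneg _) h1.le
      rw [Nat.le_div_iff_mul_le (by norm_num)]
      nlinarith
    · exact tsum_of_norm_bounded (gs.mul_left C).hasSum (bd k)

lemma full_sum {q : ℂ} (hq : q ≠ 0) (n : ℕ) :
    ∑' k : ℤ, cc q n k * ((1 - q ^ k) * (TT q (1 + k) - TT q (2 + k)))
      = 2 * (MM q n 1 - MM q n 2) := by
  have a : ∑' k : ℤ, cc q n k * (TT q (1 + k) - TT q (2 + k)) = MM q n 1 - MM q n 2 := by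
    rw [MM, MM, ← (cc_summable q n _).tsum_sub (cc_summable q n _)]
    congr 1; ext k; ring
  have b : ∑' k : ℤ, cc q n k * (q ^ k * (TT q (1 + k) - TT q (2 + k)))
      = - (MM q n 1 - MM q n 2) := by
    rw [← a, ← tsum_neg, ← (Equiv.neg ℤ).tsum_eq]
    congr 1; ext k
    simp only [Equiv.neg_apply]
    rw [cc_neg hq, show 1 + -k = -(k - 1) by ring, show 2 + -k = -(k - 2) by ring, TT_neg, TT_neg,
      show k - 1 + 3 = 2 + k by ring, show k - 2 + 3 = 1 + k by ring, zpow_neg]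
    have := zpow_ne_zero k hq
    field_simp
    ring
  have c := (cc_summable q n (fun k => TT q (1 + k) - TT q (2 + k))).tsum_sub
    (cc_summable q n (fun k => q ^ k * (TT q (1 + k) - TT q (2 + k))))
  rw [a, b] at c
  rw [two_mul, ← sub_neg_eq_add, ← c]
  congr 1; ext k; ring

theorem stmt5 (q : ℂ) (h0 : 0 < ‖q‖) (h1 : ‖q‖ < 1) (n : ℕ) :
    qpInf q q * (q ^ n - 1) * q ^ (n * (n - 1)) / qp q q (2 * n)
      = ∑ k ∈ Finset.range (n + 1),
          ((-1 : ℂ) ^ k * q ^ (k * (k - 1) / 2) * (1 - q ^ k) * H q k) /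
            (qp q q (n - k) * qp q q (n + k)) := by
  have hq : q ≠ 0 := norm_pos_iff.mp h0
  set g : ℤ → ℂ := fun k => cc q n k * ((1 - q ^ k) * (TT q (1 + k) - TT q (2 + k))) with hg
  have gsum : Summable g := cc_summable q n _
  have geven : ∀ k, g (-k) = g k := by
    intro k
    simp only [hg]
    rw [cc_neg hq, show 1 + -k = -(k - 1) by ring, show 2 + -k = -(k - 2) by ring, TT_neg, TT_neg,
      show k - 1 + 3 = 2 + k by ring, show k - 2 + 3 = 1 + k by ring, zpow_neg]
    have := zpow_ne_zero k hq
    field_simp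
    ring
  have g0 : g 0 = 0 := by simp [hg]
  have n1 : Summable (fun k : ℕ => g (k : ℤ)) := gsum.comp_injective Nat.cast_injective
  have n2 : Summable (fun k : ℕ => g ((k : ℤ) + 1)) :=
    gsum.comp_injective (i := fun k : ℕ => (k : ℤ) + 1) (fun a b h => by simpa using h)
  have s1 : ∑' k : ℤ, g k = 2 * ∑' k : ℕ, g (k : ℤ) := by
    have n3 : Summable (fun k : ℕ => g (-((k : ℤ) + 1))) := by simpa only [geven] using n2
    rw [tsum_of_nat_of_neg_add_one n1 n3]
    simp only [geven]
    have := n1.tsum_eq_zero_add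
    push_cast at this
    rw [g0, zero_add] at this
    rw [← this]; ring
  have s2 : ∑' k : ℕ, g (k : ℤ) = ∑ k ∈ Finset.range (n + 1), g (k : ℤ) := by
    apply tsum_eq_sum
    intro k hk
    rw [Finset.mem_range] at hk
    simp only [hg]
    rw [cc_zero_of q n k (by rw [Finset.mem_Icc]; omega), zero_mul]
  have s3 : ∑ k ∈ Finset.range (n + 1), g (k : ℤ) = MM q n 1 - MM q n 2 := by
    have := full_sum hq n
    rw [show (∑' k : ℤ, cc q n k * ((1 - q ^ k) * (TT q (1 + k) - TT q (2 + k)))) = ∑' k, g k from rfl,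
      s1, s2] at this
    linear_combination this / 2
  have s4 : ∑ k ∈ Finset.range (n + 1),
          ((-1 : ℂ) ^ k * q ^ (k * (k - 1) / 2) * (1 - q ^ k) * H q k) /
            (qp q q (n - k) * qp q q (n + k)) = ∑ k ∈ Finset.range (n + 1), g (k : ℤ) := by
    refine Finset.sum_congr rfl fun k hk => ?_
    rw [Finset.mem_range] at hk
    simp only [hg]
    rw [H_eq hq h1, cc, sg, rr, rr, if_neg (by omega), if_neg (by omega)]
    have t1 : ((n : ℤ) - k).toNat = n - k := by omega
    have t2 : ((n : ℤ) + k).toNat = n + k := by omega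
    have t3 : q ^ ((k : ℤ) * (k - 1) / 2) = q ^ (k * (k - 1) / 2) := by
      rw [← zpow_natCast]
      congr 1
      rcases k with _ | k
      · simp
      · push_cast; simp
    rw [t1, t2, t3, zpow_natCast, zpow_natCast]
    rw [div_eq_mul_inv, mul_inv]
    ring
  rw [s4, s3]
  have m1 := MM_closed hq h1 n
  have m2 := MM_one_two hq h1 n
  rw [TT_one hq h1] at m1
  have hqn := pow_ne_zero n hq
  have e : q ^ (n * n) = q ^ n * q ^ (n * (n - 1)) := by
    rw [← pow_add]; congr 1
    rcases n with _ | n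
    · rfl
    · simp; ring
  have m3 : MM q n 2 = q ^ (n * (n - 1)) * qpInf q q / qp q q (2 * n) := by
    apply mul_left_cancel₀ hqn
    rw [← m2, m1, e]; ring
  rw [m1, m3, e]
  ring
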